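/- Suppose premiums are adjusted according to the settled number of claims. Then for every integer u ≥ 0, every i ∈ {1,…,l}, every integer z with 0 < z ≤ u + c_i and every n ≥ 1: ψ'_i(u;z,n+1) = Σ_{j=1}^l t_{ij}(1)·ψ_j(u−z+c_i, n)·f_{XY}(0,0) + Σ_{j=1}^l Σ_{x=1}^{u−z+c_i} t_{ij}(2)·ψ_j(u−z+c_i−x, n)·f_{XY}(x,0) + (1−q)·Σ_{j=1}^l Σ_{x=1}^{u−z+c_i−1} Σ_{y=1}^{u−z+c_i−x} t_{ij}(3)·ψ_j(u−z+c_i−x−y, n)·f_{XY}(x,y) + q·Σ_{j=1}^l Σ_{x=1}^{u−z+c_i} Σ_{y=1}^{u−z+c_i−x+c_j} t_{ij}(2)·ψ'_j(u−z+c_i−x;y,n)·f_{XY}(x,y) + q·Σ_{j=1}^l Σ_{x=1}^{u−z+c_i} Σ_{y=u−z+c_i−x+c_j+1}^∞ t_{ij}(2)·f_{XY}(x,y) + (1−q)·Σ_{y=1}^∞ ξ_y(u−z+c_i) + Σ_{x=u−z+c_i+1}^∞ f_X(x), and moreover ψ'_i(u;z,1) = Σ_{x=u−z+c_i+1}^∞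 f_X(x) + (1−q)·Σ_{y=1}^∞ ξ_y(u−z+c_i). -/

import Mathlib

open scoped BigOperators

noncomputable section

namespace DelayedClaims

/-- Marginal pmf of the main claim: `f_X(x) = Σ_y f_{XY}(x,y)`. -/
def fX (f : ℕ → ℕ → ℝ) (x : ℕ) : ℝ := ∑' y : ℕ, f x y

/-- `ξ_y(m) = Σ_{x=1}^m f_{XY}(x, y + m - x)`. -/
def xi (f : ℕ → ℕ → ℝ) (y m : ℕ) : ℝ := ∑ x ∈ Finset.Icc 1 m, f x (y + m - x)

/-- Probability weight of a single period outcome `(x, y, d)`: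
`d = true` means the settlement of the by-claim `y` is delayed (probability `q`). -/
def w (f : ℕ → ℕ → ℝ) (q : ℝ) (p : ℕ × ℕ × Bool) : ℝ :=
  f p.1 p.2.1 * (if p.2.2 then q else 1 - q)

/-- Probability weight of an `n`-period path of i.i.d. period outcomes. -/
def pathWeight (f : ℕ → ℕ → ℝ) (q : ℝ) (n : ℕ) (ω : Fin n → ℕ × ℕ × Bool) : ℝ :=
  ∏ s : Fin n, w f q (ω s)

/-- Ruin indicator along a path.  Here `c` lists the premium levels,
`T i s` is the premium level following level `i` when the period adjustment
statistic equals `s`, `stat x y d carry` is the period adjustment statistic,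
`i` is the current premium level, `u` the current surplus, and `carry` the amount
of the by-claim whose settlement was delayed from the previous period (`0` if none).
In each period the premium `c i` is received up front and the settled amount
`x + (1-d)·y + carry` is paid at the end of the period; ruin occurs as soon as
the surplus becomes negative at the end of some period. -/
def ruined (l : ℕ) (c : Fin l → ℕ) (T : Fin l → ℕ → Fin l)
    (stat : ℕ → ℕ → Bool → ℕ → ℕ) :
    (n : ℕ) → (Fin n → ℕ × ℕ × Bool) → Fin l → ℤ → ℕ → Bool
  | 0, _, _, _, _ => false
  | n + 1, ω, i, u, carry =>
    let x : ℕ := (ω 0).1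
    let y : ℕ := (ω 0).2.1
    let d : Bool := (ω 0).2.2
    let u' : ℤ := u + (c i : ℤ) - ((x : ℤ) + (if d then 0 else (y : ℤ)) + (carry : ℤ))
    if u' < 0 then true
    else ruined l c T stat n (fun s => ω s.succ) (T i (stat x y d carry)) u'
      (if d then y else 0)

/-- `ψ'_i(u; z, n)`: the finite-time ruin probability over horizon `n` of the model with
an up-front delayed by-claim `z` settled at the end of period 1 (taking `z = 0` gives the
model without an up-front delayed by-claim), with initial premium level `i` and
initial surplus `u`.  By convention it equals `1` for `u < 0` and `0` for `n = 0`. -/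
def psiAux (l : ℕ) (c : Fin l → ℕ) (T : Fin l → ℕ → Fin l)
    (stat : ℕ → ℕ → Bool → ℕ → ℕ) (f : ℕ → ℕ → ℝ) (q : ℝ)
    (i : Fin l) (u : ℤ) (z : ℕ) (n : ℕ) : ℝ :=
  if u < 0 then 1
  else ∑' ω : Fin n → ℕ × ℕ × Bool,
    pathWeight f q n ω * (if ruined l c T stat n ω i u z then 1 else 0)

/-- `ψ_i(u, n)`: finite-time ruin probability without an up-front delayed by-claim. -/
def psi (l : ℕ) (c : Fin l → ℕ) (T : Fin l → ℕ → Fin l)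
    (stat : ℕ → ℕ → Bool → ℕ → ℕ) (f : ℕ → ℕ → ℝ) (q : ℝ)
    (i : Fin l) (u : ℤ) (n : ℕ) : ℝ :=
  psiAux l c T stat f q i u 0 n

/-- Adjustment statistic: aggregate reported claims `X + Y`. -/
def statRep (x y : ℕ) (_ : Bool) (_ : ℕ) : ℕ := x + y

/-- Adjustment statistic: aggregate settled claims `X + (1-D)·Y + carry`. -/
def statSet (x y : ℕ) (d : Bool) (carry : ℕ) : ℕ := x + (if d then 0 else y) + carry

/-- Adjustment statistic: reported number of claims `1{X>0} + 1{Y>0}`. -/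
def statRepN (x y : ℕ) (_ : Bool) (_ : ℕ) : ℕ :=
  (if 0 < x then 1 else 0) + (if 0 < y then 1 else 0)

/-- Adjustment statistic: settled number of claims
`1{X>0} + 1{Y>0 and not delayed} + 1{delayed by-claim from the previous period}`. -/
def statSetN (x y : ℕ) (d : Bool) (carry : ℕ) : ℕ :=
  (if 0 < x then 1 else 0) + (if 0 < y ∧ d = false then 1 else 0) +
    (if 0 < carry then 1 else 0)

theorem summable_joint {f : ℕ → ℕ → ℝ} (hfsum : ∑' p : ℕ × ℕ, f p.1 p.2 = 1) :
    Summable fun p : ℕ × ℕ => f p.1 p.2 := by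
  by_contra h
  rw [tsum_eq_zero_of_not_summable h] at hfsum
  exact zero_ne_one hfsum

theorem w_nonneg {f : ℕ → ℕ → ℝ} (hfnn : ∀ x y, 0 ≤ f x y) {q : ℝ} (hq0 : 0 ≤ q) (hq1 : q ≤ 1)
    (p : ℕ × ℕ × Bool) : 0 ≤ w f q p := by
  unfold w
  refine mul_nonneg (hfnn _ _) ?_
  split_ifs <;> linarith

/-- The weights of a single period, with the delay indicator summed out. -/
theorem hasSum_w_mul {f : ℕ → ℕ → ℝ} (hfnn : ∀ x y, 0 ≤ f x y)
    (hf : Summable fun p : ℕ × ℕ => f p.1 p.2) {q : ℝ}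
    {g : ℕ → ℕ → Bool → ℝ} (hg0 : ∀ x y d, 0 ≤ g x y d) (hg1 : ∀ x y d, g x y d ≤ 1) :
    HasSum (fun p : ℕ × ℕ × Bool => w f q p * g p.1 p.2.1 p.2.2)
      (∑' p : ℕ × ℕ, f p.1 p.2 * (q * g p.1 p.2 true + (1 - q) * g p.1 p.2 false)) := by
  have hs : ∀ (r : ℝ) (d : Bool),
      Summable fun p : ℕ × ℕ => f p.1 p.2 * r * g p.1 p.2 d := by
    intro r d
    refine Summable.of_norm_bounded (hf.mul_right |r|) fun p => ?_
    rw [Real.norm_eq_abs, abs_mul, abs_mul, abs_of_nonneg (hfnn _ _), abs_of_nonneg (hg0 _ _ _)]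
    exact mul_le_of_le_one_right (mul_nonneg (hfnn _ _) (abs_nonneg _)) (hg1 _ _ _)
  let e : (ℕ × ℕ) ⊕ (ℕ × ℕ) ≃ ℕ × ℕ × Bool :=
    (Equiv.boolProdEquivSum (ℕ × ℕ)).symm.trans
      ((Equiv.prodComm _ _).trans (Equiv.prodAssoc _ _ _))
  rw [← e.hasSum_iff]
  have h := (HasSum.sum (M := ℝ) (f := (fun p : ℕ × ℕ × Bool => w f q p * g p.1 p.2.1 p.2.2) ∘ e)
    (a := ∑' p : ℕ × ℕ, f p.1 p.2 * (1 - q) * g p.1 p.2 false)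
    (b := ∑' p : ℕ × ℕ, f p.1 p.2 * q * g p.1 p.2 true)
    (by simpa [Function.comp_def, e, w] using (hs (1 - q) false).hasSum)
    (by simpa [Function.comp_def, e, w] using (hs q true).hasSum))
  convert h using 1
  rw [← (hs _ _).tsum_add (hs _ _)]
  exact tsum_congr fun p => by ring

theorem hasSum_w {f : ℕ → ℕ → ℝ} (hfnn : ∀ x y, 0 ≤ f x y)
    (hfsum : ∑' p : ℕ × ℕ, f p.1 p.2 = 1) (q : ℝ) : HasSum (w f q) 1 := by
  have h := hasSum_w_mul hfnn (summable_joint hfsum) (q := q) (g := fun _ _ _ => 1)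
    (fun _ _ _ => zero_le_one) (fun _ _ _ => le_rfl)
  simpa [hfsum] using h

theorem pathWeight_nonneg {f : ℕ → ℕ → ℝ} (hfnn : ∀ x y, 0 ≤ f x y) {q : ℝ} (hq0 : 0 ≤ q)
    (hq1 : q ≤ 1) (n : ℕ) (ω : Fin n → ℕ × ℕ × Bool) : 0 ≤ pathWeight f q n ω :=
  Finset.prod_nonneg fun _ _ => w_nonneg hfnn hq0 hq1 _

theorem pathWeight_cons (f : ℕ → ℕ → ℝ) (q : ℝ) (n : ℕ) (p : ℕ × ℕ × Bool)
    (ω : Fin n → ℕ × ℕ × Bool) :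
    pathWeight f q (n + 1) (Fin.cons p ω) = w f q p * pathWeight f q n ω := by
  simp [pathWeight, Fin.prod_univ_succ]

theorem hasSum_pathWeight {f : ℕ → ℕ → ℝ} (hfnn : ∀ x y, 0 ≤ f x y)
    (hfsum : ∑' p : ℕ × ℕ, f p.1 p.2 = 1) {q : ℝ} (hq0 : 0 ≤ q) (hq1 : q ≤ 1) (n : ℕ) :
    HasSum (pathWeight f q n) 1 := by
  induction n with
  | zero =>
    convert hasSum_unique (pathWeight f q 0)
    simp [pathWeight]
  | succ n ih =>
    rw [← (Fin.consEquiv fun _ => ℕ × ℕ × Bool).hasSum_iff]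
    have hw := hasSum_w hfnn hfsum q
    have h := hw.mul ih (hw.summable.mul_of_nonneg ih.summable
      (fun p => w_nonneg hfnn hq0 hq1 p) (fun ω => pathWeight_nonneg hfnn hq0 hq1 n ω))
    rw [one_mul] at h
    refine Eq.subst (motive := fun F => HasSum F 1) ?_ h
    exact funext fun p => (pathWeight_cons f q n p.1 p.2).symm

theorem tsum_fin_cons {α : Type*} {n : ℕ} {F : (Fin (n + 1) → α) → ℝ} (hF : Summable F) :
    ∑' ω, F ω = ∑' (a : α) (ω : Fin n → α), F (Fin.cons a ω) := by
  rw [← (Fin.consEquiv fun _ => α).tsum_eq]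
  exact Summable.tsum_prod ((Fin.consEquiv fun _ => α).summable_iff.mpr hF)

section Ruin

variable {l : ℕ} {c : Fin l → ℕ} {T : Fin l → ℕ → Fin l} {stat : ℕ → ℕ → Bool → ℕ → ℕ}
  {f : ℕ → ℕ → ℝ} {q : ℝ}

theorem summable_pathWeight_mul_ite (hfnn : ∀ x y, 0 ≤ f x y)
    (hfsum : ∑' p : ℕ × ℕ, f p.1 p.2 = 1) (hq0 : 0 ≤ q) (hq1 : q ≤ 1) (n : ℕ)
    (A : (Fin n → ℕ × ℕ × Bool) → Bool) :
    Summable fun ω => pathWeight f q n ω * (if A ω then 1 else 0) := by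
  refine Summable.of_nonneg_of_le (fun ω => ?_) (fun ω => ?_)
    (hasSum_pathWeight hfnn hfsum hq0 hq1 n).summable
  all_goals
    have := pathWeight_nonneg hfnn hq0 hq1 n ω
    split_ifs <;> simp [this]

theorem psiAux_of_neg {u : ℤ} (hu : u < 0) (i : Fin l) (z n : ℕ) :
    psiAux l c T stat f q i u z n = 1 := if_pos hu

theorem psiAux_nonneg (hfnn : ∀ x y, 0 ≤ f x y) (hq0 : 0 ≤ q) (hq1 : q ≤ 1)
    (i : Fin l) (u : ℤ) (z n : ℕ) : 0 ≤ psiAux l c T stat f q i u z n := by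
  unfold psiAux
  split_ifs
  · exact zero_le_one
  · refine tsum_nonneg fun ω => mul_nonneg (pathWeight_nonneg hfnn hq0 hq1 n ω) ?_
    split_ifs <;> norm_num

theorem psiAux_le_one (hfnn : ∀ x y, 0 ≤ f x y) (hfsum : ∑' p : ℕ × ℕ, f p.1 p.2 = 1)
    (hq0 : 0 ≤ q) (hq1 : q ≤ 1) (i : Fin l) (u : ℤ) (z n : ℕ) :
    psiAux l c T stat f q i u z n ≤ 1 := by
  unfold psiAux
  split_ifs
  · exact le_rfl
  · have h := hasSum_pathWeight hfnn hfsum hq0 hq1 n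
    refine (Summable.tsum_le_tsum (fun ω => ?_) (summable_pathWeight_mul_ite hfnn hfsum hq0 hq1 n
      fun ω => ruined l c T stat n ω i u z) h.summable).trans_eq h.tsum_eq
    have := pathWeight_nonneg hfnn hq0 hq1 n ω
    split_ifs <;> simp [this]

theorem psiAux_zero {u : ℤ} (hu : 0 ≤ u) (i : Fin l) (z : ℕ) :
    psiAux l c T stat f q i u z 0 = 0 := by
  simp [psiAux, ruined, not_lt.mpr hu]

/-- Conditioning on the first period. -/
theorem psiAux_succ (hfnn : ∀ x y, 0 ≤ f x y) (hfsum : ∑' p : ℕ × ℕ, f p.1 p.2 = 1)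
    (hq0 : 0 ≤ q) (hq1 : q ≤ 1) {u : ℤ} (hu : 0 ≤ u) (i : Fin l) (z n : ℕ) :
    psiAux l c T stat f q i u z (n + 1) =
      ∑' p : ℕ × ℕ × Bool, w f q p *
        psiAux l c T stat f q (T i (stat p.1 p.2.1 p.2.2 z))
          (u + (c i : ℤ) - ((p.1 : ℤ) + (if p.2.2 then 0 else (p.2.1 : ℤ)) + (z : ℤ)))
          (if p.2.2 then p.2.1 else 0) n := by
  have hs := summable_pathWeight_mul_ite hfnn hfsum hq0 hq1 (n + 1)
    fun ω => ruined l c T stat (n + 1) ω i u z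
  refine (if_neg (not_lt.mpr hu)).trans ((tsum_fin_cons hs).trans (tsum_congr fun p => ?_))
  simp only [pathWeight_cons, mul_assoc]
  rw [tsum_mul_left]
  congr 1
  simp only [ruined, Fin.cons_zero, Fin.cons_succ]
  by_cases h : u + (c i : ℤ) - ((p.1 : ℤ) + (if p.2.2 then 0 else (p.2.1 : ℤ)) + (z : ℤ)) < 0
  · rw [psiAux_of_neg h]
    simpa only [if_pos h, if_true, mul_one] using
      (hasSum_pathWeight hfnn hfsum hq0 hq1 n).tsum_eq
  · simp only [psiAux, if_neg h]

/-- Ruin is certain when the delayed by-claim exceeds the surplus plus the premium. -/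
theorem psiAux_eq_one (hfnn : ∀ x y, 0 ≤ f x y) (hfsum : ∑' p : ℕ × ℕ, f p.1 p.2 = 1)
    (hq0 : 0 ≤ q) (hq1 : q ≤ 1) {u : ℤ} {i : Fin l} {z : ℕ} (hz : u + (c i : ℤ) < z) {n : ℕ}
    (hn : 1 ≤ n) : psiAux l c T stat f q i u z n = 1 := by
  obtain ⟨n, rfl⟩ := Nat.exists_eq_add_of_le' hn
  rcases lt_or_ge u 0 with hu | hu
  · exact psiAux_of_neg hu i z _
  · rw [psiAux_succ hfnn hfsum hq0 hq1 hu, ← (hasSum_w hfnn hfsum q).tsum_eq]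
    refine tsum_congr fun p => ?_
    rw [psiAux_of_neg, mul_one]
    split_ifs <;> omega

end Ruin

theorem sum_Icc_add_tsum {a : ℕ → ℝ} (ha : Summable fun k => a (k + 1)) (m : ℕ) :
    ∑' k : ℕ, a (k + 1) = ∑ x ∈ Finset.Icc 1 m, a x + ∑' k : ℕ, a (m + 1 + k) := by
  rw [← ha.sum_add_tsum_nat_add m]
  congr 1
  · rw [Finset.range_eq_Ico, Finset.sum_Ico_add' a 0 m 1]
    rfl
  · exact tsum_congr fun k => congrArg a (by omega)

theorem tsum_xi {f : ℕ → ℕ → ℝ} (hf : Summable fun p : ℕ × ℕ => f p.1 p.2) (m : ℕ) :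
    ∑' k : ℕ, xi f (k + 1) m = ∑ x ∈ Finset.Icc 1 m, ∑' k : ℕ, f x (m - x + 1 + k) := by
  have h : ∀ k : ℕ, xi f (k + 1) m = ∑ x ∈ Finset.Icc 1 m, f x (m - x + 1 + k) := fun k =>
    Finset.sum_congr rfl fun x hx => by
      congr 1
      have := (Finset.mem_Icc.mp hx).2
      omega
  simp only [h]
  exact Summable.tsum_finsetSum fun x _ =>
    (hf.prod_factor x).comp_injective (add_right_injective (m - x + 1))

/-- One-period recursion under the settled number of claims, valid for every horizon. -/
theorem psiAux_succ_statSetN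
    {l : ℕ} {c : Fin l → ℕ} {T : Fin l → ℕ → Fin l}
    {f : ℕ → ℕ → ℝ} (hfnn : ∀ x y, 0 ≤ f x y)
    (hfsum : ∑' p : ℕ × ℕ, f p.1 p.2 = 1)
    (hfdeg : ∀ y : ℕ, 0 < y → f 0 y = 0)
    {q : ℝ} (hq0 : 0 ≤ q) (hq1 : q ≤ 1)
    {u : ℕ} {i : Fin l} {z : ℕ} (hz1 : 0 < z) {m : ℕ} (hm : m + z = u + c i) (n : ℕ) :
    psiAux l c T statSetN f q i (u : ℤ) z (n + 1) =
      psi l c T statSetN f q (T i 1) (m : ℤ) n * f 0 0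
      + (∑ x ∈ Finset.Icc 1 m, psi l c T statSetN f q (T i 2) ((m - x : ℕ) : ℤ) n * f x 0)
      + (1 - q) * (∑ x ∈ Finset.Icc 1 m, ∑ y ∈ Finset.Icc 1 (m - x),
          psi l c T statSetN f q (T i 3) ((m - x - y : ℕ) : ℤ) n * f x y)
      + q * (∑ x ∈ Finset.Icc 1 m, ∑' k : ℕ,
          psiAux l c T statSetN f q (T i 2) ((m - x : ℕ) : ℤ) (k + 1) n * f x (k + 1))
      + (1 - q) * (∑' k : ℕ, xi f (k + 1) m)
      + ∑' k : ℕ, fX f (m + 1 + k) := by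
  have hf := summable_joint hfsum
  set g : ℕ → ℕ → Bool → ℝ := fun x y d =>
    psiAux l c T statSetN f q (T i (statSetN x y d z))
      ((u : ℤ) + (c i : ℤ) - ((x : ℤ) + (if d then 0 else (y : ℤ)) + (z : ℤ)))
      (if d then y else 0) n with hg
  have hg0 : ∀ x y d, 0 ≤ g x y d := fun x y d => psiAux_nonneg hfnn hq0 hq1 _ _ _ _
  have hg1 : ∀ x y d, g x y d ≤ 1 := fun x y d => psiAux_le_one hfnn hfsum hq0 hq1 _ _ _ _
  have hfg : ∀ d, Summable fun p : ℕ × ℕ => f p.1 p.2 * g p.1 p.2 d := fun d =>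
    Summable.of_nonneg_of_le (fun p => mul_nonneg (hfnn _ _) (hg0 _ _ _))
      (fun p => mul_le_of_le_one_right (hfnn _ _) (hg1 _ _ _)) hf
  have hF : Summable fun p : ℕ × ℕ =>
      f p.1 p.2 * (q * g p.1 p.2 true + (1 - q) * g p.1 p.2 false) :=
    (((hfg true).mul_left q).add ((hfg false).mul_left (1 - q))).congr fun p => by ring
  have hstep : psiAux l c T statSetN f q i (u : ℤ) z (n + 1) =
      ∑' p : ℕ × ℕ, f p.1 p.2 * (q * g p.1 p.2 true + (1 - q) * g p.1 p.2 false) :=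
    (psiAux_succ hfnn hfsum hq0 hq1 (Int.natCast_nonneg u) i z n).trans
      (hasSum_w_mul hfnn hf hg0 hg1).tsum_eq
  clear_value g
  have hrow : ∑' p : ℕ × ℕ, f p.1 p.2 * (q * g p.1 p.2 true + (1 - q) * g p.1 p.2 false) =
      ∑' y : ℕ, f 0 y * (q * g 0 y true + (1 - q) * g 0 y false)
      + (∑ x ∈ Finset.Icc 1 m, ∑' y : ℕ, f x y * (q * g x y true + (1 - q) * g x y false)
        + ∑' k : ℕ, ∑' y : ℕ, f (m + 1 + k) y *
          (q * g (m + 1 + k) y true + (1 - q) * g (m + 1 + k) y false)) := by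
    rw [hF.tsum_prod, hF.prod.tsum_eq_zero_add]
    exact congrArg _ (sum_Icc_add_tsum
      (a := fun x => ∑' y : ℕ, f x y * (q * g x y true + (1 - q) * g x y false))
      ((summable_nat_add_iff 1).mpr hF.prod) m)
  have hzero : ∑' y : ℕ, f 0 y * (q * g 0 y true + (1 - q) * g 0 y false) =
      psi l c T statSetN f q (T i 1) (m : ℤ) n * f 0 0 := by
    rw [tsum_eq_single 0 fun y hy => by rw [hfdeg y (Nat.pos_of_ne_zero hy), zero_mul]]
    have hu : (u : ℤ) + (c i : ℤ) - z = m := by omega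
    simp only [hg, statSetN, psi, hz1, if_true, lt_irrefl, if_false, false_and, Bool.false_eq_true,
      Nat.cast_zero, zero_add, hu]
    ring
  have htail : ∀ k : ℕ, ∑' y : ℕ, f (m + 1 + k) y *
      (q * g (m + 1 + k) y true + (1 - q) * g (m + 1 + k) y false) = fX f (m + 1 + k) := by
    intro k
    refine tsum_congr fun y => ?_
    have h : ∀ d, g (m + 1 + k) y d = 1 := fun d => by
      rw [hg]
      exact psiAux_of_neg (by split_ifs <;> push_cast <;> omega) _ _ _
    rw [h, h]
    ring
  have hmid : ∀ x ∈ Finset.Icc 1 m,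
      ∑' y : ℕ, f x y * (q * g x y true + (1 - q) * g x y false) =
        psi l c T statSetN f q (T i 2) ((m - x : ℕ) : ℤ) n * f x 0
        + (1 - q) * (∑ y ∈ Finset.Icc 1 (m - x),
            psi l c T statSetN f q (T i 3) ((m - x - y : ℕ) : ℤ) n * f x y)
        + q * (∑' k : ℕ,
            psiAux l c T statSetN f q (T i 2) ((m - x : ℕ) : ℤ) (k + 1) n * f x (k + 1))
        + (1 - q) * ∑' k : ℕ, f x (m - x + 1 + k) := by
    intro x hx
    obtain ⟨hx1, hxm⟩ := Finset.mem_Icc.mp hx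
    have hx0 : 0 < x := hx1
    have ht : ∀ y, g x y true =
        psiAux l c T statSetN f q (T i 2) ((m - x : ℕ) : ℤ) y n := by
      intro y
      have hu : (u : ℤ) + (c i : ℤ) - ((x : ℤ) + z) = ((m - x : ℕ) : ℤ) := by omega
      simp [hg, statSetN, hz1, hx0, hu]
    have hfalse0 : g x 0 false = psi l c T statSetN f q (T i 2) ((m - x : ℕ) : ℤ) n := by
      have hu : (u : ℤ) + (c i : ℤ) - ((x : ℤ) + z) = ((m - x : ℕ) : ℤ) := by omega
      simp [hg, statSetN, hz1, hx0, hu, psi]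
    have hfalse : ∀ y ∈ Finset.Icc 1 (m - x), f x y * g x y false =
        psi l c T statSetN f q (T i 3) ((m - x - y : ℕ) : ℤ) n * f x y := by
      intro y hy
      obtain ⟨hy1, hym⟩ := Finset.mem_Icc.mp hy
      have hy0 : 0 < y := hy1
      have hu : (u : ℤ) + (c i : ℤ) - ((x : ℤ) + y + z) = ((m - x - y : ℕ) : ℤ) := by omega
      simp [hg, statSetN, hz1, hx0, hy0, hu, psi, mul_comm]
    have hfalse' : ∀ k : ℕ, f x (m - x + 1 + k) * g x (m - x + 1 + k) false =
        f x (m - x + 1 + k) := by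
      intro k
      have h : g x (m - x + 1 + k) false = 1 := by
        rw [hg]
        refine psiAux_of_neg ?_ _ _ _
        simp only [Bool.false_eq_true, if_false]
        omega
      rw [h, mul_one]
    have hsf : Summable fun y => f x y * g x y false := (hfg false).prod_factor x
    have hst : Summable fun y => f x y * g x y true := (hfg true).prod_factor x
    have hsplit : ∑' y : ℕ, f x y * (q * g x y true + (1 - q) * g x y false) =
        q * ∑' y : ℕ, f x y * g x y true + (1 - q) * ∑' y : ℕ, f x y * g x y false := by
      rw [← tsum_mul_left, ← tsum_mul_left, ← (hst.mul_left q).tsum_add (hsf.mul_left (1 - q))]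
      exact tsum_congr fun y => by ring
    have htsum : ∑' y : ℕ, f x y * g x y true =
        psi l c T statSetN f q (T i 2) ((m - x : ℕ) : ℤ) n * f x 0 + ∑' k : ℕ,
          psiAux l c T statSetN f q (T i 2) ((m - x : ℕ) : ℤ) (k + 1) n * f x (k + 1) := by
      rw [hst.tsum_eq_zero_add]
      exact congrArg₂ (· + ·) (by rw [ht, mul_comm]; rfl)
        (tsum_congr fun k => by rw [ht, mul_comm])
    have hfsum' : ∑' y : ℕ, f x y * g x y false =
        psi l c T statSetN f q (T i 2) ((m - x : ℕ) : ℤ) n * f x 0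
        + (∑ y ∈ Finset.Icc 1 (m - x),
            psi l c T statSetN f q (T i 3) ((m - x - y : ℕ) : ℤ) n * f x y
          + ∑' k : ℕ, f x (m - x + 1 + k)) := by
      rw [hsf.tsum_eq_zero_add, sum_Icc_add_tsum (a := fun y => f x y * g x y false)
        ((summable_nat_add_iff 1).mpr hsf) (m - x)]
      exact congrArg₂ (· + ·) (by rw [hfalse0, mul_comm])
        (congrArg₂ (· + ·) (Finset.sum_congr rfl hfalse) (tsum_congr hfalse'))
    refine hsplit.trans
      ((congrArg₂ (fun a b => q * a + (1 - q) * b) htsum hfsum').trans ?_)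
    ring
  refine hstep.trans (hrow.trans ((congrArg₂ (· + ·) hzero (congrArg₂ (· + ·)
    (Finset.sum_congr rfl hmid) (tsum_congr htail))).trans ?_))
  rw [tsum_xi hf]
  simp only [Finset.sum_add_distrib, Finset.mul_sum]
  ring

/-- Corollary 4: recursion for ψ' when premiums are adjusted according to
the settled number of claims (the up-front delayed by-claim z adds 1 to the
period-1 statistic). -/
theorem corollary4_settled_number
    (l : ℕ) (c : Fin l → ℕ) (hcpos : ∀ i, 0 < c i) (hcmono : StrictMono c)
    (f : ℕ → ℕ → ℝ) (hfnn : ∀ x y, 0 ≤ f x y)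
    (hfsum : ∑' p : ℕ × ℕ, f p.1 p.2 = 1)
    (hfdeg : ∀ y : ℕ, 0 < y → f 0 y = 0)
    (q : ℝ) (hq0 : 0 ≤ q) (hq1 : q ≤ 1)
    (t : Fin l → Fin l → ℕ → ℝ) (T : Fin l → ℕ → Fin l)
    (hT : ∀ i j s, t i j s = if j = T i s then (1 : ℝ) else 0)
    (u : ℕ) (i : Fin l) (z : ℕ) (hz1 : 0 < z) (hz2 : z ≤ u + c i) (n : ℕ) (hn : 1 ≤ n) :
    psiAux l c T statSetN f q i (u : ℤ) z (n + 1) =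
        (∑ j : Fin l, t i j 1 * psi l c T statSetN f q j ((u + c i - z : ℕ) : ℤ) n * f 0 0)
      + (∑ j : Fin l, ∑ x ∈ Finset.Icc 1 (u + c i - z),
          t i j 2 * psi l c T statSetN f q j ((u + c i - z - x : ℕ) : ℤ) n * f x 0)
      + (1 - q) * (∑ j : Fin l, ∑ x ∈ Finset.Icc 1 (u + c i - z - 1),
          ∑ y ∈ Finset.Icc 1 (u + c i - z - x),
            t i j 3 * psi l c T statSetN f q j ((u + c i - z - x - y : ℕ) : ℤ) n * f x y)
      + q * (∑ j : Fin l, ∑ x ∈ Finset.Icc 1 (u + c i - z),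
          ∑ y ∈ Finset.Icc 1 (u + c i - z - x + c j),
            t i j 2 * psiAux l c T statSetN f q j ((u + c i - z - x : ℕ) : ℤ) y n * f x y)
      + q * (∑ j : Fin l, ∑ x ∈ Finset.Icc 1 (u + c i - z), ∑' k : ℕ,
          t i j 2 * f x (u + c i - z - x + c j + 1 + k))
      + (1 - q) * (∑' k : ℕ, xi f (k + 1) (u + c i - z))
      + (∑' k : ℕ, fX f (u + c i - z + 1 + k)) ∧
    psiAux l c T statSetN f q i (u : ℤ) z 1 =
      (∑' k : ℕ, fX f (u + c i - z + 1 + k))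
      + (1 - q) * (∑' k : ℕ, xi f (k + 1) (u + c i - z)) := by
  obtain ⟨m, hm⟩ := Nat.exists_eq_add_of_le' hz2
  have hmz : u + c i - z = m := by omega
  have hf := summable_joint hfsum
  have hsel : ∀ (s : ℕ) (F : Fin l → ℝ), ∑ j : Fin l, t i j s * F j = F (T i s) := by
    intro s F
    simp [hT]
  rw [hmz]
  constructor
  · have h1 : ∑ j : Fin l, t i j 1 * psi l c T statSetN f q j (m : ℤ) n * f 0 0 =
        psi l c T statSetN f q (T i 1) (m : ℤ) n * f 0 0 := by
      simp only [mul_assoc]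
      exact hsel 1 _
    have h2 : ∑ j : Fin l, ∑ x ∈ Finset.Icc 1 m,
          t i j 2 * psi l c T statSetN f q j ((m - x : ℕ) : ℤ) n * f x 0 =
        ∑ x ∈ Finset.Icc 1 m, psi l c T statSetN f q (T i 2) ((m - x : ℕ) : ℤ) n * f x 0 := by
      simp only [mul_assoc, ← Finset.mul_sum]
      exact hsel 2 _
    have h3 : ∑ j : Fin l, ∑ x ∈ Finset.Icc 1 (m - 1), ∑ y ∈ Finset.Icc 1 (m - x),
          t i j 3 * psi l c T statSetN f q j ((m - x - y : ℕ) : ℤ) n * f x y =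
        ∑ x ∈ Finset.Icc 1 m, ∑ y ∈ Finset.Icc 1 (m - x),
          psi l c T statSetN f q (T i 3) ((m - x - y : ℕ) : ℤ) n * f x y := by
      simp only [mul_assoc, ← Finset.mul_sum]
      rw [hsel 3]
      refine Finset.sum_subset (Finset.Icc_subset_Icc_right (Nat.sub_le m 1)) fun x hx hx' => ?_
      have hxm : m - x = 0 := by
        simp only [Finset.mem_Icc] at hx hx'
        omega
      simp [hxm]
    have h4 : ∑ j : Fin l, ∑ x ∈ Finset.Icc 1 m, ∑ y ∈ Finset.Icc 1 (m - x + c j),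
          t i j 2 * psiAux l c T statSetN f q j ((m - x : ℕ) : ℤ) y n * f x y =
        ∑ x ∈ Finset.Icc 1 m, ∑ y ∈ Finset.Icc 1 (m - x + c (T i 2)),
          psiAux l c T statSetN f q (T i 2) ((m - x : ℕ) : ℤ) y n * f x y := by
      simp only [mul_assoc, ← Finset.mul_sum]
      exact hsel 2 _
    have h5 : ∑ j : Fin l, ∑ x ∈ Finset.Icc 1 m, ∑' k : ℕ,
          t i j 2 * f x (m - x + c j + 1 + k) =
        ∑ x ∈ Finset.Icc 1 m, ∑' k : ℕ, f x (m - x + c (T i 2) + 1 + k) := by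
      simp only [tsum_mul_left, ← Finset.mul_sum]
      exact hsel 2 fun j => ∑ x ∈ Finset.Icc 1 m, ∑' k : ℕ, f x (m - x + c j + 1 + k)
    have hsplit : ∀ x ∈ Finset.Icc 1 m, ∑' k : ℕ,
          psiAux l c T statSetN f q (T i 2) ((m - x : ℕ) : ℤ) (k + 1) n * f x (k + 1) =
        ∑ y ∈ Finset.Icc 1 (m - x + c (T i 2)),
            psiAux l c T statSetN f q (T i 2) ((m - x : ℕ) : ℤ) y n * f x y
          + ∑' k : ℕ, f x (m - x + c (T i 2) + 1 + k) := by
      intro x _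
      have hs : Summable fun y : ℕ =>
          psiAux l c T statSetN f q (T i 2) ((m - x : ℕ) : ℤ) y n * f x y :=
        Summable.of_nonneg_of_le
          (fun y => mul_nonneg (psiAux_nonneg hfnn hq0 hq1 _ _ _ _) (hfnn _ _))
          (fun y => mul_le_of_le_one_left (hfnn _ _)
            (psiAux_le_one hfnn hfsum hq0 hq1 _ _ _ _)) (hf.prod_factor x)
      rw [sum_Icc_add_tsum (a := fun y : ℕ =>
          psiAux l c T statSetN f q (T i 2) ((m - x : ℕ) : ℤ) y n * f x y)
        ((summable_nat_add_iff 1).mpr hs) (m - x + c (T i 2))]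
      congr 1
      refine tsum_congr fun k => ?_
      rw [psiAux_eq_one hfnn hfsum hq0 hq1 (by push_cast; omega) hn, one_mul]
    rw [h1, h2, h3, h4, h5, psiAux_succ_statSetN hfnn hfsum hfdeg hq0 hq1 hz1 hm.symm n,
      Finset.sum_congr rfl hsplit, Finset.sum_add_distrib]
    ring
  · rw [psiAux_succ_statSetN hfnn hfsum hfdeg hq0 hq1 hz1 hm.symm 0]
    simp only [psi, psiAux_zero (Int.natCast_nonneg _), zero_mul, Finset.sum_const_zero,
      tsum_zero, mul_zero, zero_add]
    ring

end DelayedClaims
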